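/- arXiv:2501.05696 — 2 statements merged into one kernel-verified Lean document; each statement's English description precedes it below -/
import Mathlib

section
/- Let λ, x, y, z be real numbers with y ≠ 0, and let n, p be nonnegative integers. Then ∑_{k=0}^{n} (−1)^k · C(x, k) · (z+yk)_{p,λ} = ∑_{r=0}^{p} C(p,r) · (z)_{p−r,λ} · y^r · ∑_{j=0}^{r} (−1)^j · C(n−x, n−j) · C(x, j) · j! · {r brace j}_{λ/y}, where binomial coefficients with real upper arguments are generalized binomial coefficients. -/
/-- The degenerate falling factorial `(x)_{n,λ} = x(x-λ)⋯(x-(n-1)λ)`. -/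
noncomputable def dff (lam x : ℝ) (n : ℕ) : ℝ := ∏ i ∈ Finset.range n, (x - i * lam)

/-- The degenerate Stirling number of the second kind
`{n brace k}_λ = (1/k!) ∑_{j=0}^{k} C(k,j) (-1)^{k-j} (j)_{n,λ}`. -/
noncomputable def dstirling (lam : ℝ) (n k : ℕ) : ℝ :=
  (1 / (k.factorial : ℝ)) *
    ∑ j ∈ Finset.range (k + 1), (k.choose j : ℝ) * (-1) ^ (k - j) * dff lam (j : ℝ) n

/-- The generalized binomial coefficient `C(x,m) = x(x-1)⋯(x-m+1)/m!` with real upper argument. -/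
noncomputable def gchoose (x : ℝ) (m : ℕ) : ℝ := (∏ i ∈ Finset.range m, (x - i)) / m.factorial

/-- Generalized binomial coefficient with integer lower argument; zero when the lower
argument is negative. -/
noncomputable def gchooseZ (x : ℝ) (m : ℤ) : ℝ := if 0 ≤ m then gchoose x m.toNat else 0

open Finset in
theorem dff_add (lam a b : ℝ) (p : ℕ) :
    dff lam (a + b) p =
      ∑ r ∈ range (p + 1), (p.choose r : ℝ) * dff lam a (p - r) * dff lam b r := by
  have dff_succ (x : ℝ) (n : ℕ) : dff lam x (n + 1) = dff lam x n * (x - n * lam) := by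
    simp [dff, prod_range_succ]
  rw [← Nat.sum_antidiagonal_eq_sum_range_succ_mk
    (fun rs : ℕ × ℕ => (p.choose rs.1 : ℝ) * dff lam a rs.2 * dff lam b rs.1)]
  induction p with
  | zero => simp [dff]
  | succ p ih =>
    simp only [mul_assoc] at ih ⊢
    rw [dff_succ, ih, sum_antidiagonal_choose_succ_mul
      (fun i j => dff lam a j * dff lam b i), sum_mul, ← sum_add_distrib]
    refine sum_congr rfl fun rs hrs => ?_
    have hp : (p : ℝ) = rs.1 + rs.2 := by exact_mod_cast (mem_antidiagonal.mp hrs).symm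
    rw [Nat.choose_symm_of_eq_add (mem_antidiagonal.mp hrs).symm, dff_succ, dff_succ, hp]
    ring

theorem dff_mul_left (lam : ℝ) {y : ℝ} (hy : y ≠ 0) (t : ℝ) (r : ℕ) :
    dff lam (y * t) r = y ^ r * dff (lam / y) t r := by
  unfold dff
  rw [show y ^ r = ∏ _i ∈ Finset.range r, y by simp, ← Finset.prod_mul_distrib]
  exact Finset.prod_congr rfl fun i _ => by field_simp

theorem factorial_mul_dstirling (lam : ℝ) (r j : ℕ) :
    (j.factorial : ℝ) * dstirling lam r j = (fwdDiff 1)^[j] (fun t : ℝ => dff lam t r) 0 := by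
  rw [fwdDiff_iter_eq_sum_shift, dstirling, ← mul_assoc,
    mul_one_div_cancel (by exact_mod_cast j.factorial_ne_zero), one_mul]
  exact Finset.sum_congr rfl fun i _ => by simp [mul_comm]

open Polynomial in
theorem dstirling_eq_zero_of_lt (lam : ℝ) {r j : ℕ} (h : r < j) : dstirling lam r j = 0 := by
  let P : ℝ[X] := ∏ i ∈ Finset.range r, (X - C ((i : ℝ) * lam))
  have hP : (fun t : ℝ => dff lam t r) = P.eval := by
    ext t
    simp [P, dff, eval_prod]
  have hdeg : P.natDegree < j := by
    rwa [natDegree_finsetProd_X_sub_C_eq_card, Finset.card_range]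
  have hfact := factorial_mul_dstirling lam r j
  rw [hP, fwdDiff_iter_eq_zero_of_degree_lt hdeg, Pi.zero_apply] at hfact
  exact (mul_eq_zero.mp hfact).resolve_left (by exact_mod_cast j.factorial_ne_zero)

open Finset in
theorem dff_natCast_eq_sum_dstirling (lam : ℝ) (k r : ℕ) :
    dff lam k r = ∑ j ∈ range (r + 1), (k.choose j : ℝ) * (j.factorial * dstirling lam r j) := by
  have newton := shift_eq_sum_fwdDiff_iter (1 : ℝ) (fun t : ℝ => dff lam t r) k 0
  simp only [zero_add, nsmul_eq_mul, mul_one, ← factorial_mul_dstirling] at newton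
  rw [newton]
  trans ∑ j ∈ range (k + r + 1), (k.choose j : ℝ) * (j.factorial * dstirling lam r j)
  · refine sum_subset (range_subset_range.mpr (by omega)) fun j _ hj => ?_
    rw [Nat.choose_eq_zero_of_lt (by simpa using hj)]
    simp
  · refine (sum_subset (range_subset_range.mpr (by omega)) fun j _ hj => ?_).symm
    rw [dstirling_eq_zero_of_lt lam (by simpa using hj)]
    simp

theorem gchoose_eq_ringChoose (x : ℝ) (m : ℕ) : gchoose x m = Ring.choose x m := by
  rw [Ring.choose_eq_smul, ← Polynomial.aeval_eq_smeval, ← Polynomial.eval_map_algebraMap,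
    descPochhammer_map, descPochhammer_eval_eq_prod_range, gchoose, smul_eq_mul, div_eq_inv_mul]

theorem gchoose_add_mul_choose (x : ℝ) (j m : ℕ) :
    gchoose x (j + m) * ((j + m).choose j : ℝ) =
      (-1) ^ m * gchoose (j + m - 1 - x) m * gchoose x j := by
  have hsplit := Ring.choose_smul_choose x (Nat.le_add_right j m)
  have hreflect := Ring.choose_neg (x - j - m + 1) m
  rw [show -(x - j - m + 1) = j + m - 1 - x by ring,
    show x - j - m + 1 + m - 1 = x - j by ring, Units.smul_def, zsmul_eq_mul] at hreflect
  rw [Nat.add_sub_cancel_left, nsmul_eq_mul] at hsplit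
  simp only [gchoose_eq_ringChoose]
  rw [hreflect, mul_comm, hsplit]
  have hsign : (-1 : ℝ) ^ m * (-1) ^ m = 1 := by rw [← mul_pow]; simp
  simp only [Int.coe_negOnePow_natCast, Int.cast_pow, Int.cast_neg, Int.cast_one]
  linear_combination (-(Ring.choose (x - j) m) * Ring.choose x j) * hsign

theorem sum_neg_one_pow_mul_gchoose_mul_choose (x : ℝ) (n j : ℕ) :
    ∑ k ∈ Finset.range (n + 1), (-1 : ℝ) ^ k * gchoose x k * (k.choose j : ℝ) =
      (-1) ^ j * gchooseZ ((n : ℝ) - x) ((n : ℤ) - (j : ℤ)) * gchoose x j := by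
  rcases lt_or_ge n j with h | h
  · rw [gchooseZ, if_neg (by omega)]
    simp only [mul_zero, zero_mul]
    refine Finset.sum_eq_zero fun k hk => ?_
    rw [Nat.choose_eq_zero_of_lt (by have := Finset.mem_range.mp hk; omega)]
    simp
  · obtain ⟨m, rfl⟩ := Nat.exists_eq_add_of_le h
    rw [gchooseZ, if_pos (by omega), show (((j + m : ℕ) : ℤ) - (j : ℤ)).toNat = m by omega]
    clear h
    induction m with
    | zero =>
      rw [Finset.sum_range_succ, Finset.sum_eq_zero fun k hk => by
        rw [Nat.choose_eq_zero_of_lt (by simpa using hk)]; simp]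
      simp [gchoose]
    | succ m ih =>
      have pascal := Ring.choose_succ_succ ((j : ℝ) + m - x) m
      have hterm := gchoose_add_mul_choose x j (m + 1)
      simp only [← gchoose_eq_ringChoose] at pascal
      have hsign : (-1 : ℝ) ^ m * (-1) ^ m = 1 := by rw [← mul_pow]; simp
      rw [← add_assoc] at hterm ⊢
      rw [Finset.sum_range_succ, ih, mul_assoc _ (gchoose x (j + m + 1)), hterm]
      push_cast
      rw [show (j : ℝ) + m + 1 - x = j + m - x + 1 by ring, pascal,
        show (j : ℝ) + (m + 1) - 1 - x = j + m - x by ring]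
      linear_combination (-1 : ℝ) ^ j * gchoose (j + m - x) (m + 1) * gchoose x j * hsign

theorem alternating_sum_gchoose_dff_general (lam x y z : ℝ) (hy : y ≠ 0) (n p : ℕ) :
    ∑ k ∈ Finset.range (n + 1), (-1 : ℝ) ^ k * gchoose x k * dff lam (z + y * k) p =
      ∑ r ∈ Finset.range (p + 1),
        (p.choose r : ℝ) * dff lam z (p - r) * y ^ r *
          ∑ j ∈ Finset.range (r + 1),
            (-1 : ℝ) ^ j * gchooseZ ((n : ℝ) - x) ((n : ℤ) - (j : ℤ)) * gchoose x j *
              (j.factorial : ℝ) * dstirling (lam / y) r j := by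
  simp_rw [dff_add, dff_mul_left lam hy, dff_natCast_eq_sum_dstirling, Finset.mul_sum]
  rw [Finset.sum_comm]
  refine Finset.sum_congr rfl fun r _ => ?_
  rw [Finset.sum_comm]
  refine Finset.sum_congr rfl fun j _ => ?_
  rw [← sum_neg_one_pow_mul_gchoose_mul_choose, Finset.sum_mul, Finset.sum_mul, Finset.mul_sum]
  exact Finset.sum_congr rfl fun k _ => by ring
end

section
/- Let λ and x be real numbers and let r be a nonnegative integer. Then K_{r+1}(x|λ) = x · ∑_{j=0}^{r} C(r, j) · K_j(x|λ) · (1−λ)_{r−j,λ}, where C(r,j) is the usual binomial coefficient. -/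
/-- `K_r(x|λ) = ∑_{n=0}^{∞} (x^n/n!) (n)_{r,λ}`. -/
noncomputable def Kr (lam x : ℝ) (r : ℕ) : ℝ :=
  ∑' n : ℕ, x ^ n / (n.factorial : ℝ) * dff lam (n : ℝ) r

theorem dff_succ (lam x : ℝ) (n : ℕ) : dff lam x (n + 1) = dff lam x n * (x - n * lam) :=
  Finset.prod_range_succ _ _

theorem dff_succ' (lam x : ℝ) (n : ℕ) : dff lam x (n + 1) = x * dff lam (x - lam) n := by
  rw [dff, dff, Finset.prod_range_succ', mul_comm]
  congr 1
  · simp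
  · refine Finset.prod_congr rfl fun i _ => ?_
    push_cast
    ring

/-- The Vandermonde identity for degenerate falling factorials. -/
theorem dff_add_s13 (lam x y : ℝ) (n : ℕ) :
    dff lam (x + y) n =
      ∑ j ∈ Finset.range (n + 1), (n.choose j : ℝ) * dff lam x j * dff lam y (n - j) := by
  rw [← Finset.Nat.sum_antidiagonal_eq_sum_range_succ
    (fun i j => (n.choose i : ℝ) * dff lam x i * dff lam y j)]
  induction n with
  | zero => simp [dff]
  | succ n ih =>
    have h := Finset.sum_antidiagonal_choose_succ_mul (fun i j => dff lam x i * dff lam y j) n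
    simp only [← mul_assoc] at h
    rw [h, dff_succ, ih, Finset.sum_mul, ← Finset.sum_add_distrib]
    refine Finset.sum_congr rfl fun p hp => ?_
    have hp' : p.1 + p.2 = n := Finset.HasAntidiagonal.mem_antidiagonal.mp hp
    have hchoose : n.choose p.2 = n.choose p.1 := by
      rw [← hp', Nat.choose_symm_add]
    rw [dff_succ, dff_succ, hchoose, ← hp']
    push_cast
    ring

theorem Kr_term_zero (lam x : ℝ) (r : ℕ) :
    x ^ 0 / ((0 : ℕ).factorial : ℝ) * dff lam ((0 : ℕ) : ℝ) (r + 1) = 0 := by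
  simp [dff_succ']

theorem Kr_term_succ (lam x : ℝ) (r n : ℕ) :
    x ^ (n + 1) / ((n + 1).factorial : ℝ) * dff lam ((n + 1 : ℕ) : ℝ) (r + 1) =
      x * ∑ j ∈ Finset.range (r + 1), (r.choose j : ℝ) *
        (x ^ n / (n.factorial : ℝ) * dff lam (n : ℝ) j) * dff lam (1 - lam) (r - j) := by
  have hsum : ∑ j ∈ Finset.range (r + 1), (r.choose j : ℝ) *
        (x ^ n / (n.factorial : ℝ) * dff lam (n : ℝ) j) * dff lam (1 - lam) (r - j) =
      x ^ n / (n.factorial : ℝ) * dff lam (n + (1 - lam)) r := by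
    rw [dff_add_s13, Finset.mul_sum]
    exact Finset.sum_congr rfl fun j _ => by ring
  have hn : (n : ℝ) + 1 ≠ 0 := by positivity
  have hf : (n.factorial : ℝ) ≠ 0 := by positivity
  rw [hsum, dff_succ', Nat.factorial_succ, ← add_sub_assoc]
  push_cast
  field_simp
  ring

theorem summable_Kr (lam x : ℝ) (r : ℕ) :
    Summable fun n : ℕ => x ^ n / (n.factorial : ℝ) * dff lam (n : ℝ) r := by
  induction r using Nat.strong_induction_on with
  | _ r ih =>
    cases r with
    | zero => simpa [dff] using Real.summable_pow_div_factorial x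
    | succ r =>
      rw [← summable_nat_add_iff 1]
      simp only [Kr_term_succ]
      exact (summable_sum fun j hj =>
        ((ih j (Finset.mem_range.mp hj)).mul_left _).mul_right _).mul_left x

theorem Kr_recurrence (lam x : ℝ) (r : ℕ) :
    Kr lam x (r + 1) =
      x * ∑ j ∈ Finset.range (r + 1), (r.choose j : ℝ) * Kr lam x j * dff lam (1 - lam) (r - j) := by
  rw [Kr, (summable_Kr lam x (r + 1)).tsum_eq_zero_add, Kr_term_zero, zero_add]
  simp only [Kr_term_succ]
  rw [tsum_mul_left, Summable.tsum_finsetSum fun j _ =>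
    ((summable_Kr lam x j).mul_left _).mul_right _]
  simp only [tsum_mul_left, tsum_mul_right, Kr]
end
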